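/- arXiv:2202.13408 — 2 statements merged into one kernel-verified Lean document; each statement's English description precedes it below -/
import Mathlib

section
/- For all positive real numbers B and pm, every natural number N ≥ 3 and every natural number NF with 2 ≤ NF ≤ N, the maximum concurrent replication throughput strictly exceeds the single-primary replication throughput: NF·B/((N-1)·pm + (NF-1)·pm) > B/((N-1)·pm). -/
/-- Maximum concurrent replication throughput strictly exceeds the
single-primary replication throughput. -/
theorem concurrent_gt_single_primary
    (B pm : ℝ) (hB : 0 < B) (hpm : 0 < pm)
    (N NF : ℕ) (hN : 3 ≤ N) (hNF : 2 ≤ NF) (hNFN : NF ≤ N) :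
    (NF : ℝ) * B / (((N : ℝ) - 1) * pm + ((NF : ℝ) - 1) * pm)
      > B / (((N : ℝ) - 1) * pm) := by
  have hN' : (3 : ℝ) ≤ N := by exact_mod_cast hN
  have hNF' : (2 : ℝ) ≤ NF := by exact_mod_cast hNF
  have hsingle : 0 < ((N : ℝ) - 1) * pm := mul_pos (by linarith) hpm
  have hextra : 0 < ((NF : ℝ) - 1) * pm := mul_pos (by linarith) hpm
  have hgap : 0 < B * (((NF : ℝ) - 1) * pm) * ((N : ℝ) - 2) :=
    mul_pos (mul_pos hB hextra) (by linarith)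
  rw [gt_iff_lt, div_lt_div_iff₀ hsingle (add_pos hsingle hextra)]
  linarith
end

section
/- Fix positive reals B, sm, a natural number N ≥ 3 and a natural number NF with 2 ≤ NF. As pm → ∞, the ratio T_DQPBFT(pm)/T_PBFT(pm) = [NF·B/((N-1)(pm+3sm) + (NF-1)(pm+4(N-1)sm) + (N-1)·4sm)] / [B/((N-1)(pm+3sm))] tends to NF·(N-1)/(N+NF-2), which is strictly greater than 1. -/
open Filter

/-- A ratio of affine functions tends at infinity to the ratio of the leading coefficients. -/
theorem tendsto_affine_div_affine_atTop (a b d : ℝ) {c : ℝ} (hc : c ≠ 0) :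
    Tendsto (fun x : ℝ => (a * x + b) / (c * x + d)) atTop (nhds (a / c)) := by
  have key (p q : ℝ) : Tendsto (fun x : ℝ => p + q * x⁻¹) atTop (nhds p) := by
    simpa using (tendsto_inv_atTop_zero.const_mul q).const_add p
  refine ((key a b).div (key c d) hc).congr' ?_
  filter_upwards [eventually_gt_atTop 0] with x hx
  rw [Pi.div_apply, ← mul_div_mul_right _ _ hx.ne']
  congr 1 <;> field_simp

/-- As the payload size `pm` tends to infinity, the throughput ratio
`T_DQPBFT / T_PBFT` tends to `NF·(N-1)/(N+NF-2)`, which exceeds `1`. -/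
theorem dqpbft_pbft_ratio_limit
    (B sm : ℝ) (hB : 0 < B) (hsm : 0 < sm)
    (N NF : ℕ) (hN : 3 ≤ N) (hNF : 2 ≤ NF) :
    Tendsto
      (fun pm : ℝ =>
        ((NF : ℝ) * B /
            (((N : ℝ) - 1) * (pm + 3 * sm)
              + ((NF : ℝ) - 1) * (pm + 4 * ((N : ℝ) - 1) * sm)
              + ((N : ℝ) - 1) * (4 * sm)))
          / (B / (((N : ℝ) - 1) * (pm + 3 * sm))))
      atTop (nhds ((NF : ℝ) * ((N : ℝ) - 1) / ((N : ℝ) + (NF : ℝ) - 2)))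
    ∧ 1 < (NF : ℝ) * ((N : ℝ) - 1) / ((N : ℝ) + (NF : ℝ) - 2) := by
  have hN' : (3 : ℝ) ≤ N := by exact_mod_cast hN
  have hNF' : (2 : ℝ) ≤ NF := by exact_mod_cast hNF
  have hc : 0 < (N : ℝ) + NF - 2 := by linarith
  constructor
  · refine (tendsto_affine_div_affine_atTop (NF * ((N : ℝ) - 1)) (NF * ((N : ℝ) - 1) * (3 * sm))
      (((N : ℝ) - 1) * (3 * sm) + ((NF : ℝ) - 1) * (4 * ((N : ℝ) - 1) * sm)
        + ((N : ℝ) - 1) * (4 * sm)) hc.ne').congr fun pm => ?_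
    rw [div_div_div_eq, mul_assoc (NF : ℝ) B, mul_left_comm (NF : ℝ) B, mul_comm _ B,
      mul_div_mul_left _ _ hB.ne']
    congr 1 <;> ring
  · rw [one_lt_div hc]
    nlinarith
end
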